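/- Let ω : ℝ^p → ℝ be convex and Lipschitz continuous, and let F : ℝ^n → ℝ^p be differentiable with Lipschitz continuous derivative F'. Suppose the sequence (x_k) in ℝ^n converges to x* and that Ψ_k(1) → 0 as k → ∞, where Ψ_k(1) = ω(F(x_k)) − min_{‖d‖_LP ≤ 1} ω(F(x_k) + F'(x_k) d). Then x* is a critical point, i.e., ω(F(x*)) ≤ ω(F(x*) + F'(x*) d) for all d ∈ ℝ^n with ‖d‖_LP ≤ 1. -/

import Mathlib

/-- The closed unit ball of any norm on a finite-dimensional real normed space is bounded for the
ambient norm. -/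
theorem isBounded_unitBall_of_norm_axioms {E : Type*} [NormedAddCommGroup E] [NormedSpace ℝ E]
    [FiniteDimensional ℝ E] (N : E → ℝ) (htri : ∀ u v, N (u + v) ≤ N u + N v)
    (hsmul : ∀ (c : ℝ) u, N (c • u) = |c| * N u) (hdef : ∀ u, N u = 0 → u = 0) :
    Bornology.IsBounded {d | N d ≤ 1} := by
  have hconv : ConvexOn ℝ Set.univ N := by
    refine ⟨convex_univ, fun u _ v _ a b ha hb _ => (htri _ _).trans_eq ?_⟩
    simp [hsmul, abs_of_nonneg ha, abs_of_nonneg hb]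
  have hcont : Continuous N := hconv.locallyLipschitz.continuous
  have hzero : N 0 = 0 := by simpa using hsmul 0 0
  have hnonneg (u : E) : 0 ≤ N u := by
    have hneg : N (-u) = N u := by simpa using hsmul (-1) u
    have := htri u (-u)
    rw [add_neg_cancel, hzero, hneg] at this
    linarith
  rcases subsingleton_or_nontrivial E with hE | hE
  · exact (Set.toFinite _).isBounded
  obtain ⟨w, hw, hmin⟩ := (isCompact_sphere (0 : E) 1).exists_isMinOn
    (NormedSpace.sphere_nonempty.mpr zero_le_one) hcont.continuousOn
  have hw1 : ‖w‖ = 1 := by simpa using hw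
  have hNw : 0 < N w := (hnonneg w).lt_of_ne fun h => by simp [hdef w h.symm] at hw1
  refine isBounded_iff_forall_norm_le.mpr ⟨(N w)⁻¹, fun d (hd : N d ≤ 1) => ?_⟩
  rcases eq_or_ne d 0 with rfl | hd0
  · simpa using hNw.le
  have hdpos : 0 < ‖d‖ := norm_pos_iff.mpr hd0
  have hle : N w ≤ N (‖d‖⁻¹ • d) :=
    hmin (by simp [norm_smul, hdpos.ne'])
  rw [hsmul, abs_of_pos (inv_pos.mpr hdpos)] at hle
  have hle1 : N w ≤ ‖d‖⁻¹ :=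
    hle.trans (mul_le_of_le_one_right (inv_pos.mpr hdpos).le hd)
  exact (le_inv_comm₀ hNw hdpos).mp hle1


/-- If `ω` is convex and Lipschitz, `F` differentiable and
Lipschitz with Lipschitz derivative `F'`, `x_k → x*`, and the criticality
measure `Ψₖ(1) = ω(F(xₖ)) − min_{nLP d ≤ 1} ω(F(xₖ) + F'(xₖ) d)` tends to zero,
then `x*` is a critical point: `ω(F(x*)) ≤ ω(F(x*) + F'(x*) d)` for all `d`
with `nLP d ≤ 1`. -/
theorem criticality_limit
    (n p : ℕ)
    (ω : EuclideanSpace ℝ (Fin p) → ℝ) (Lω : ℝ)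
    (hωconv : ConvexOn ℝ Set.univ ω)
    (hωLip : ∀ u v, |ω u - ω v| ≤ Lω * ‖u - v‖)
    (nLP : EuclideanSpace ℝ (Fin n) → ℝ)
    (hLPtri : ∀ u v, nLP (u + v) ≤ nLP u + nLP v)
    (hLPsmul : ∀ (c : ℝ) u, nLP (c • u) = |c| * nLP u)
    (hLPdef : ∀ u, nLP u = 0 → u = 0)
    (F : EuclideanSpace ℝ (Fin n) → EuclideanSpace ℝ (Fin p))
    (F' : EuclideanSpace ℝ (Fin n) →
      (EuclideanSpace ℝ (Fin n) →L[ℝ] EuclideanSpace ℝ (Fin p)))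
    (hF : ∀ x, HasFDerivAt F (F' x) x)
    (LF LF' : ℝ)
    (hFLip : ∀ x y, ‖F x - F y‖ ≤ LF * ‖x - y‖)
    (hF'Lip : ∀ x y, ‖F' x - F' y‖ ≤ LF' * ‖x - y‖)
    (x : ℕ → EuclideanSpace ℝ (Fin n))
    (xstar : EuclideanSpace ℝ (Fin n))
    (hx : Filter.Tendsto x Filter.atTop (nhds xstar))
    (hΨ : Filter.Tendsto
      (fun k => ω (F (x k)) -
        sInf ((fun d => ω (F (x k) + F' (x k) d)) '' {d | nLP d ≤ 1}))
      Filter.atTop (nhds 0)) :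
    ∀ d : EuclideanSpace ℝ (Fin n), nLP d ≤ 1 →
      ω (F xstar) ≤ ω (F xstar + F' xstar d) := by
  intro d hd
  have hωcont : Continuous ω := (LipschitzWith.of_dist_le' (K := Lω) fun u v => by
    simpa [Real.dist_eq, dist_eq_norm] using hωLip u v).continuous
  have hF'cont : Continuous F' := (LipschitzWith.of_dist_le' (K := LF') fun u v => by
    simpa [dist_eq_norm] using hF'Lip u v).continuous
  have hFcont : Continuous F := continuous_iff_continuousAt.mpr fun y => (hF y).continuousAt
  have hcompact : IsCompact (closure {d | nLP d ≤ 1}) :=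
    (isBounded_unitBall_of_norm_axioms nLP hLPtri hLPsmul hLPdef).isCompact_closure
  have hbdd (y : EuclideanSpace ℝ (Fin n)) :
      BddBelow ((fun d => ω (F y + F' y d)) '' {d | nLP d ≤ 1}) :=
    (hcompact.bddBelow_image (by fun_prop)).mono (Set.image_mono subset_closure)
  have hlim : Filter.Tendsto (fun k => ω (F (x k)) - ω (F (x k) + F' (x k) d)) Filter.atTop
      (nhds (ω (F xstar) - ω (F xstar + F' xstar d))) := by
    have hcont : Continuous fun y => ω (F y) - ω (F y + F' y d) := by fun_prop
    exact (hcont.tendsto xstar).comp hx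
  exact sub_nonpos.mp <| le_of_tendsto_of_tendsto' hlim hΨ fun k =>
    sub_le_sub_left (csInf_le (hbdd (x k)) ⟨d, hd, rfl⟩) _
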